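/- If F is a 2-edge-connected subgraph of a graph G, then G/E(F), the graph obtained from G by contracting all edges of F, is a cc-minor of G. -/

import Mathlib

open scoped Classical

noncomputable section

/-- A finite multigraph with vertices and edge names drawn from `ℕ`.
Each edge name `e ∈ E` has a pair of (possibly equal) endpoints `ends e`. -/
structure MGraph where
  V : Finset ℕ
  E : Finset ℕ
  ends : ℕ → Sym2 ℕ
  ends_mem : ∀ e ∈ E, ∀ v ∈ ends e, v ∈ V

namespace MGraph

/-- Adjacency via some edge. -/
def Adj (G : MGraph) (u v : ℕ) : Prop := ∃ e ∈ G.E, G.ends e = s(u, v)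

/-- Reachability. -/
def Reach (G : MGraph) : ℕ → ℕ → Prop := Relation.ReflTransGen G.Adj

/-- A graph is connected if it has a vertex and all vertices are mutually reachable. -/
def Connected (G : MGraph) : Prop :=
  G.V.Nonempty ∧ ∀ u ∈ G.V, ∀ v ∈ G.V, G.Reach u v

/-- Delete a set of edges. -/
def deleteEdges (G : MGraph) (Z : Finset ℕ) : MGraph where
  V := G.V
  E := G.E \ Z
  ends := G.ends
  ends_mem := fun e he => G.ends_mem e (Finset.mem_sdiff.mp he).1

/-- A graph with at least two vertices is `k`-edge-connected if deleting any
set of fewer than `k` edges leaves it connected. -/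
def EdgeConnected (G : MGraph) (k : ℕ) : Prop :=
  2 ≤ G.V.card ∧ ∀ Z ⊆ G.E, Z.card < k → (G.deleteEdges Z).Connected

/-- A graph is loopless if no edge has equal endpoints. -/
def Loopless (G : MGraph) : Prop := ∀ e ∈ G.E, ¬ (G.ends e).IsDiag

/-- The set of vertices met by an edge set. -/
def vertsOf (G : MGraph) (C : Finset ℕ) : Finset ℕ :=
  G.V.filter (fun v => ∃ e ∈ C, v ∈ G.ends e)

/-- Degree of `v` in the edge set `C` (loops counted twice). -/
def degIn (G : MGraph) (C : Finset ℕ) (v : ℕ) : ℕ :=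
  ∑ e ∈ C, (if G.ends e = s(v, v) then 2 else if v ∈ G.ends e then 1 else 0)

/-- `C` is the edge set of a cycle of `G`: a nonempty connected edge set in which
every vertex met has degree exactly two (a loop and a pair of parallel edges are cycles). -/
def IsCycleSet (G : MGraph) (C : Finset ℕ) : Prop :=
  C.Nonempty ∧ C ⊆ G.E ∧
  (∀ v ∈ G.vertsOf C, G.degIn C v = 2) ∧
  ∀ u ∈ G.vertsOf C, ∀ v ∈ G.vertsOf C,
    Relation.ReflTransGen (fun a b => ∃ e ∈ C, G.ends e = s(a, b)) u v

/-- The vertex map identifying all vertices of `U` (within `G.V`) to a single one. -/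
def cmapOn (G : MGraph) (U : Finset ℕ) : ℕ → ℕ :=
  fun v => if v ∈ U ∩ G.V then sInf {w : ℕ | w ∈ U ∩ G.V} else v

/-- Contract the vertex set `U` to a single vertex, deleting the edges of `S` and all
newly created loops (edges with both ends in `U` that were not already loops), while
keeping pre-existing loops not in `S`. -/
def contractOn (G : MGraph) (U S : Finset ℕ) : MGraph where
  V := G.V.image (G.cmapOn U)
  E := G.E.filter (fun e => ¬ (∀ v ∈ G.ends e, v ∈ U) ∨ ((G.ends e).IsDiag ∧ e ∉ S))
  ends := fun e => (G.ends e).map (G.cmapOn U)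
  ends_mem := by
    intro e he v hv
    have he' : e ∈ G.E := (Finset.mem_filter.mp he).1
    rw [Sym2.mem_map] at hv
    obtain ⟨w, hw, rfl⟩ := hv
    have hwV : w ∈ G.V := G.ends_mem e he' w hw
    by_cases h : w ∈ U ∩ G.V
    · have hmem : sInf {x : ℕ | x ∈ U ∩ G.V} ∈ U ∩ G.V := Nat.sInf_mem ⟨w, h⟩
      refine Finset.mem_image.mpr ⟨sInf {x : ℕ | x ∈ U ∩ G.V},
        (Finset.mem_inter.mp hmem).2, ?_⟩
      simp [cmapOn, h, hmem]
    · exact Finset.mem_image.mpr ⟨w, hwV, by simp [cmapOn, h]⟩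

/-- Contract a cycle (given by its edge set), deleting all created loops. -/
def contractCycle (G : MGraph) (C : Finset ℕ) : MGraph :=
  G.contractOn (G.vertsOf C) C

/-- `H` is a cycle-contraction minor (cc-minor) of `G`: `H` is obtained from `G` by
a sequence of cycle contractions (each accompanied by contraction of created loops). -/
def CCMinor (G H : MGraph) : Prop :=
  Relation.ReflTransGen (fun A B => ∃ C, A.IsCycleSet C ∧ B = A.contractCycle C) G H

/-- Walks: a vertex list together with a matching edge list. -/
inductive IsWalk (G : MGraph) : List ℕ → List ℕ → Prop
  | nil {v : ℕ} (hv : v ∈ G.V) : IsWalk G [v] []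
  | cons {u v : ℕ} {e : ℕ} {vs es : List ℕ} (he : e ∈ G.E)
      (hends : G.ends e = s(u, v)) (hw : IsWalk G (v :: vs) es) :
      IsWalk G (u :: v :: vs) (e :: es)

/-- A path from `u` to `v`, given by its vertex list and edge list. -/
def IsPathBetween (G : MGraph) (u v : ℕ) (vs es : List ℕ) : Prop :=
  G.IsWalk vs es ∧ vs.Nodup ∧ vs.head? = some u ∧ vs.getLast? = some v

/-- `G` is `k`-connected: it has at least `k` vertices and any two distinct vertices are
joined by at least `k` pairwise internally disjoint paths. -/
def KConnected (G : MGraph) (k : ℕ) : Prop :=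
  k ≤ G.V.card ∧ ∀ u ∈ G.V, ∀ v ∈ G.V, u ≠ v →
    ∃ P : Fin k → List ℕ × List ℕ,
      (∀ i, G.IsPathBetween u v (P i).1 (P i).2) ∧
      ∀ i j, i ≠ j →
        (∀ x, x ∈ (P i).1 → x ∈ (P j).1 → x = u ∨ x = v) ∧
        (∀ e, e ∈ (P i).2 → e ∉ (P j).2)

/-- A simple graph: no loops and no parallel edges. -/
def Simple (G : MGraph) : Prop :=
  G.Loopless ∧ ∀ e ∈ G.E, ∀ f ∈ G.E, G.ends e = G.ends f → e = f

/-- Graph isomorphism. -/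
def Iso (G H : MGraph) : Prop :=
  ∃ φ ψ : ℕ → ℕ, Set.BijOn φ ↑G.V ↑H.V ∧ Set.BijOn ψ ↑G.E ↑H.E ∧
    ∀ e ∈ G.E, H.ends (ψ e) = (G.ends e).map φ

/-- The bond graph `B n`: two vertices joined by `n` parallel edges. -/
def IsBondGraph (H : MGraph) (n : ℕ) : Prop :=
  ∃ u v : ℕ, u ≠ v ∧ H.V = {u, v} ∧ H.E.card = n ∧ ∀ e ∈ H.E, H.ends e = s(u, v)

end MGraph

namespace MGraph

/-- `F` is a subgraph of `G`. -/
def IsSubgraph (F G : MGraph) : Prop :=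
  F.V ⊆ G.V ∧ F.E ⊆ G.E ∧ ∀ e ∈ F.E, F.ends e = G.ends e

end MGraph

namespace MGraph

/-- `G.EdgeStep S a b` says that some edge of `S` joins `a` to `b` in `G`. -/
def EdgeStep (G : MGraph) (S : Finset ℕ) (a b : ℕ) : Prop := ∃ e ∈ S, G.ends e = s(a, b)

/-- `G.PathFrom A u W C v` says that `C ⊆ A` is the edge set of a path of `G` from `u` to `v`
with vertex set `W`. -/
inductive PathFrom (G : MGraph) (A : Finset ℕ) (u : ℕ) : Finset ℕ → Finset ℕ → ℕ → Prop
  | refl : PathFrom G A u {u} ∅ u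
  | snoc {W C : Finset ℕ} {v x e : ℕ} (h : PathFrom G A u W C v) (he : e ∈ A)
      (hends : G.ends e = s(v, x)) (hx : x ∉ W) : PathFrom G A u (insert x W) (insert e C) x

variable {G : MGraph} {A S U W C : Finset ℕ} {u v a b e : ℕ}

theorem EdgeStep.symm (h : G.EdgeStep S a b) : G.EdgeStep S b a := by
  obtain ⟨e, he, h⟩ := h
  exact ⟨e, he, h.trans Sym2.eq_swap⟩

theorem EdgeStep.reflTransGen_symm (h : Relation.ReflTransGen (G.EdgeStep S) a b) :
    Relation.ReflTransGen (G.EdgeStep S) b a :=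
  have : Std.Symm (G.EdgeStep S) := ⟨fun _ _ => EdgeStep.symm⟩
  Relation.ReflTransGen.stdSymm.symm _ _ h

theorem EdgeStep.reflTransGen_insert (h : Relation.ReflTransGen (G.EdgeStep S) a b) :
    Relation.ReflTransGen (G.EdgeStep (insert e S)) a b :=
  Relation.ReflTransGen.mono (p := G.EdgeStep (insert e S))
    (fun _ _ ⟨f, hf, h⟩ => ⟨f, Finset.mem_insert_of_mem hf, h⟩) _ _ h

theorem PathFrom.subset (h : G.PathFrom A u W C v) : C ⊆ A := by
  induction h with
  | refl => simp
  | snoc h he _ _ ih => exact Finset.insert_subset he ih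

theorem PathFrom.mem (h : G.PathFrom A u W C v) : v ∈ W := by
  cases h <;> simp

theorem PathFrom.ends_mem (h : G.PathFrom A u W C v) : ∀ e ∈ C, ∀ w ∈ G.ends e, w ∈ W := by
  induction h with
  | refl => simp
  | snoc h he hends hx ih =>
    have := h.mem
    intro f hf w hw
    rcases Finset.mem_insert.mp hf with rfl | hf
    · rw [hends, Sym2.mem_iff] at hw
      grind
    · exact Finset.mem_insert_of_mem (ih f hf w hw)

theorem PathFrom.truncate (h : G.PathFrom A u W C v) :
    ∀ x ∈ W, ∃ W' C', G.PathFrom A u W' C' x := by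
  induction h with
  | refl =>
    intro x hx
    rw [Finset.mem_singleton.mp hx]
    exact ⟨_, _, .refl⟩
  | snoc h he hends hx ih =>
    intro y hy
    rcases Finset.mem_insert.mp hy with rfl | hy
    · exact ⟨_, _, h.snoc he hends hx⟩
    · exact ih y hy

theorem PathFrom.of_reach (h : Relation.ReflTransGen (G.EdgeStep A) u v) :
    ∃ W C, G.PathFrom A u W C v := by
  induction h with
  | refl => exact ⟨_, _, .refl⟩
  | @tail b c _ hbc ih =>
    obtain ⟨W, C, hp⟩ := ih
    obtain ⟨e, he, hends⟩ := hbc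
    by_cases hc : c ∈ W
    · exact hp.truncate c hc
    · exact ⟨_, _, hp.snoc he hends hc⟩

theorem degIn_insert (he : e ∉ C) (hends : G.ends e = s(a, b)) (w : ℕ) :
    G.degIn (insert e C) w =
      G.degIn C w + (if w = a then 1 else 0) + (if w = b then 1 else 0) := by
  unfold degIn
  rw [Finset.sum_insert he, hends]
  simp only [Sym2.eq_iff, Sym2.mem_iff]
  grind

theorem PathFrom.degIn_add (h : G.PathFrom A u W C v) (w : ℕ) :
    G.degIn C w + (if w = u then 1 else 0) + (if w = v then 1 else 0) =
      if w ∈ W then 2 else 0 := by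
  induction h with
  | refl => simp only [degIn, Finset.sum_empty, Finset.mem_singleton]; grind
  | @snoc W C v x e h he hends hx ih =>
    have heC : e ∉ C := fun hC => hx (h.ends_mem e hC x (by simp [hends]))
    rw [degIn_insert heC hends]
    grind

theorem PathFrom.reach (h : G.PathFrom A u W C v) :
    ∀ w ∈ W, Relation.ReflTransGen (G.EdgeStep C) u w := by
  induction h with
  | refl =>
    intro w hw
    rw [Finset.mem_singleton.mp hw]
  | @snoc W C v x e h he hends hx ih =>
    have hmono : ∀ w ∈ W, Relation.ReflTransGen (G.EdgeStep (insert e C)) u w := fun w hw =>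
      EdgeStep.reflTransGen_insert (ih w hw)
    intro w hw
    rcases Finset.mem_insert.mp hw with rfl | hw
    · exact (hmono v h.mem).tail ⟨e, Finset.mem_insert_self _ _, hends⟩
    · exact hmono w hw

/-- A path together with a further edge joining its ends is a cycle. -/
theorem PathFrom.isCycleSet_insert (h : G.PathFrom A u W C v) (hA : A ⊆ G.E) (heE : e ∈ G.E)
    (heA : e ∉ A) (hends : G.ends e = s(u, v)) : G.IsCycleSet (insert e C) := by
  have hu : u ∈ W := by
    have := h.degIn_add u
    grind
  have hverts : ∀ w ∈ G.vertsOf (insert e C), w ∈ W := by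
    intro w hw
    obtain ⟨f, hf, hwf⟩ := (Finset.mem_filter.mp hw).2
    rcases Finset.mem_insert.mp hf with rfl | hf
    · rw [hends, Sym2.mem_iff] at hwf
      rcases hwf with rfl | rfl
      exacts [hu, h.mem]
    · exact h.ends_mem f hf w hwf
  have hreach : ∀ w ∈ W, Relation.ReflTransGen (G.EdgeStep (insert e C)) u w := fun w hw =>
    EdgeStep.reflTransGen_insert (h.reach w hw)
  refine ⟨Finset.insert_nonempty _ _, Finset.insert_subset heE (h.subset.trans hA), ?_, ?_⟩
  · intro w hw
    rw [degIn_insert (fun hC => heA (h.subset hC)) hends, h.degIn_add, if_pos (hverts w hw)]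
  · intro x hx y hy
    exact (EdgeStep.reflTransGen_symm (hreach x (hverts x hx))).trans (hreach y (hverts y hy))

theorem cmapOn_of_mem (hU : U ⊆ G.V) (h : v ∈ U) : G.cmapOn U v = sInf (U : Set ℕ) := by
  simp [cmapOn, Finset.inter_eq_left.mpr hU, h]

theorem cmapOn_of_notMem (h : v ∉ U) : G.cmapOn U v = v := by
  simp [cmapOn, h]

theorem cmapOn_mem (hU : U ⊆ G.V) (h : v ∈ U) : G.cmapOn U v ∈ U := by
  rw [cmapOn_of_mem hU h]
  exact Nat.sInf_mem (s := (U : Set ℕ)) ⟨v, h⟩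

theorem cmapOn_le (hU : U ⊆ G.V) (v : ℕ) : G.cmapOn U v ≤ v := by
  by_cases h : v ∈ U
  · rw [cmapOn_of_mem hU h]
    exact Nat.sInf_le h
  · rw [cmapOn_of_notMem h]

theorem cmapOn_mem_iff (hU : U ⊆ G.V) (hUW : U ⊆ W) : G.cmapOn U v ∈ W ↔ v ∈ W := by
  by_cases h : v ∈ U
  · exact iff_of_true (hUW (cmapOn_mem hU h)) (hUW h)
  · rw [cmapOn_of_notMem h]

theorem cmapOn_mem_image_iff (hU : U ⊆ G.V) (hUW : U ⊆ W) :
    G.cmapOn U v ∈ W.image (G.cmapOn U) ↔ v ∈ W := by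
  refine ⟨fun h => ?_, Finset.mem_image_of_mem _⟩
  obtain ⟨w, hw, hwv⟩ := Finset.mem_image.mp h
  rw [← cmapOn_mem_iff hU hUW, ← hwv]
  exact (cmapOn_mem_iff hU hUW).mpr hw

theorem cmapOn_eq_iff (hU : U ⊆ G.V) :
    G.cmapOn U a = G.cmapOn U b ↔ a = b ∨ a ∈ U ∧ b ∈ U := by
  by_cases ha : a ∈ U <;> by_cases hb : b ∈ U
  · simp [cmapOn_of_mem hU, ha, hb]
  · have := cmapOn_mem hU ha
    rw [cmapOn_of_notMem hb]
    grind
  · have := cmapOn_mem hU hb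
    rw [cmapOn_of_notMem ha]
    grind
  · simp [cmapOn_of_notMem, ha, hb]

theorem cmapOn_cmapOn (hU : U ⊆ G.V) (hUW : U ⊆ W) (hW : W ⊆ G.V) (v : ℕ) :
    (G.contractOn U S).cmapOn (W.image (G.cmapOn U)) (G.cmapOn U v) = G.cmapOn W v := by
  have hW' : W.image (G.cmapOn U) ⊆ (G.contractOn U S).V := Finset.image_subset_image hW
  by_cases hv : v ∈ W
  · rw [cmapOn_of_mem hW' (Finset.mem_image_of_mem _ hv), cmapOn_of_mem hW hv]
    apply le_antisymm
    · have hm : sInf (W : Set ℕ) ∈ W := Nat.sInf_mem (s := (W : Set ℕ)) ⟨v, hv⟩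
      exact (Nat.sInf_le (Finset.mem_coe.mpr (Finset.mem_image_of_mem _ hm))).trans
        (cmapOn_le hU _)
    · have hm : sInf (↑(W.image (G.cmapOn U)) : Set ℕ) ∈ W.image (G.cmapOn U) :=
        Nat.sInf_mem (s := (↑(W.image (G.cmapOn U)) : Set ℕ))
          ⟨_, Finset.mem_image_of_mem _ hv⟩
      obtain ⟨w, hw, hwm⟩ := Finset.mem_image.mp hm
      rw [← hwm]
      exact Nat.sInf_le ((cmapOn_mem_iff hU hUW).mpr hw)
  · rw [cmapOn_of_notMem (mt (cmapOn_mem_image_iff hU hUW).mp hv),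
      cmapOn_of_notMem (fun h => hv (hUW h)), cmapOn_of_notMem hv]

theorem mem_contractOn_E (hends : G.ends e = s(a, b)) :
    e ∈ (G.contractOn U S).E ↔ e ∈ G.E ∧ (¬ (a ∈ U ∧ b ∈ U) ∨ a = b ∧ e ∉ S) := by
  simp only [contractOn, Finset.mem_filter, hends, Sym2.ball, Sym2.mk_isDiag_iff]

protected theorem ext {G H : MGraph} (hV : G.V = H.V) (hE : G.E = H.E)
    (hends : G.ends = H.ends) : G = H := by
  cases G
  cases H
  simp_all

/-- Contracting part of a vertex set first does not change the result of contracting all of it. -/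
theorem contractOn_contractOn (hU : U ⊆ G.V) (hUW : U ⊆ W) (hW : W ⊆ G.V) (hCS : C ⊆ S) :
    (G.contractOn U C).contractOn (W.image (G.cmapOn U)) (S ∩ (G.contractOn U C).E) =
      G.contractOn W S := by
  have hcomp : (G.contractOn U C).cmapOn (W.image (G.cmapOn U)) ∘ G.cmapOn U = G.cmapOn W :=
    funext (cmapOn_cmapOn hU hUW hW)
  apply MGraph.ext
  · change (G.V.image _).image _ = G.V.image _
    rw [Finset.image_image, hcomp]
  · ext e
    obtain ⟨a, b, hab⟩ : ∃ a b, G.ends e = s(a, b) := by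
      induction h : G.ends e with
      | _ a b => exact ⟨a, b, rfl⟩
    have hab' : (G.contractOn U C).ends e = s(G.cmapOn U a, G.cmapOn U b) := by
      simp [contractOn, hab]
    rw [mem_contractOn_E hab', Finset.mem_inter, mem_contractOn_E hab, mem_contractOn_E hab,
      cmapOn_mem_image_iff hU hUW, cmapOn_mem_image_iff hU hUW, cmapOn_eq_iff hU]
    have := @hCS e
    have := @hUW a
    have := @hUW b
    tauto
  · funext e
    change Sym2.map _ (Sym2.map _ (G.ends e)) = Sym2.map _ (G.ends e)
    rw [Sym2.map_map, hcomp]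

theorem contractOn_singleton (hu : u ∈ G.V) : G.contractOn {u} ∅ = G := by
  have hid : G.cmapOn {u} = id := by
    funext v
    have hU : ({u} : Finset ℕ) ⊆ G.V := Finset.singleton_subset_iff.mpr hu
    by_cases hv : v ∈ ({u} : Finset ℕ)
    · rw [id, Finset.mem_singleton.mp hv]
      exact Finset.mem_singleton.mp (cmapOn_mem hU (Finset.mem_singleton_self u))
    · exact cmapOn_of_notMem hv
  apply MGraph.ext
  · simp [contractOn, hid]
  · ext e
    induction hab : G.ends e with
    | _ a b =>
      rw [mem_contractOn_E hab]
      simp only [Finset.mem_singleton, Finset.notMem_empty]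
      grind
  · funext e
    simp [contractOn, hid]

/-- Contracting a vertex set `W` spanned by a bridgeless connected edge set `S` can be done by
cycle contractions. Unlike 2-edge-connectedness, the hypotheses allow `W` to be a singleton. -/
theorem ccMinor_contractOn_of_bridgeless (n : ℕ) : ∀ (G : MGraph) (W S : Finset ℕ), S.card = n →
    W.Nonempty → W ⊆ G.V → S ⊆ G.E → (∀ e ∈ S, ∀ v ∈ G.ends e, v ∈ W) →
    (∀ Z ⊆ S, Z.card < 2 → ∀ u ∈ W, ∀ v ∈ W,
      Relation.ReflTransGen (G.EdgeStep (S \ Z)) u v) →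
    G.CCMinor (G.contractOn W S) := by
  induction n using Nat.strong_induction_on with
  | _ n ih =>
  intro G W S hn hne hW hS hends hconn
  rcases S.eq_empty_or_nonempty with rfl | ⟨e, he⟩
  · obtain ⟨u, hu⟩ := hne
    have hWu : W = {u} := by
      refine Finset.eq_singleton_iff_unique_mem.mpr ⟨hu, fun v hv => ?_⟩
      rcases (hconn ∅ subset_rfl (by simp) v hv u hu).cases_head with h | ⟨_, ⟨f, hf, _⟩, _⟩
      · exact h
      · simp at hf
    subst hWu
    rw [contractOn_singleton (hW hu)]
    exact Relation.ReflTransGen.refl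
  obtain ⟨C, hCS, hC⟩ : ∃ C ⊆ S, G.IsCycleSet C := by
    induction hab : G.ends e with
    | _ a b =>
      obtain ⟨P, C, hp⟩ := PathFrom.of_reach (hconn {e} (by simpa using he) (by simp)
        a (hends e he a (by simp [hab])) b (hends e he b (by simp [hab])))
      exact ⟨insert e C, Finset.insert_subset he (hp.subset.trans Finset.sdiff_subset),
        hp.isCycleSet_insert (Finset.sdiff_subset.trans hS) (hS he) (by simp) hab⟩
  have hU : G.vertsOf C ⊆ G.V := Finset.filter_subset _ _
  have hUW : G.vertsOf C ⊆ W := by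
    intro v hv
    obtain ⟨f, hf, hvf⟩ := (Finset.mem_filter.mp hv).2
    exact hends f (hCS hf) v hvf
  refine Relation.ReflTransGen.head ⟨C, hC, rfl⟩ ?_
  rw [← contractOn_contractOn hU hUW hW hCS]
  refine ih _ ?_ (G.contractCycle C) _ _ rfl (hne.image _) (Finset.image_subset_image hW)
    Finset.inter_subset_right ?_ ?_
  · rw [← hn]
    refine Finset.card_lt_card ⟨Finset.inter_subset_left, fun hsub => ?_⟩
    obtain ⟨f, hf⟩ := hC.1
    have hfE := (Finset.mem_filter.mp (Finset.mem_inter.mp (hsub (hCS hf))).2).2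
    rcases hfE with h | h
    · exact h fun v hv => Finset.mem_filter.mpr ⟨G.ends_mem f (hS (hCS hf)) v hv, f, hf, hv⟩
    · exact h.2 hf
  · intro f hf v hv
    obtain ⟨w, hw, rfl⟩ := Sym2.mem_map.mp hv
    exact Finset.mem_image_of_mem _ (hends f (Finset.mem_inter.mp hf).1 w hw)
  · intro Z hZ hZ2 u hu v hv
    obtain ⟨x, hx, rfl⟩ := Finset.mem_image.mp hu
    obtain ⟨y, hy, rfl⟩ := Finset.mem_image.mp hv
    refine Relation.ReflTransGen.lift' (G.cmapOn (G.vertsOf C)) ?_ _ _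
      (hconn Z (hZ.trans Finset.inter_subset_left) hZ2 x hx y hy)
    rintro a b ⟨f, hf, hab⟩
    obtain ⟨hfS, hfZ⟩ := Finset.mem_sdiff.mp hf
    by_cases hfE : f ∈ (G.contractCycle C).E
    · refine Relation.ReflTransGen.single
        ⟨f, Finset.mem_sdiff.mpr ⟨Finset.mem_inter.mpr ⟨hfS, hfE⟩, hfZ⟩, ?_⟩
      simp [contractCycle, contractOn, hab]
    · have habU : a ∈ G.vertsOf C ∧ b ∈ G.vertsOf C := by
        by_contra hn
        exact hfE ((mem_contractOn_E hab).mpr ⟨hS hfS, Or.inl hn⟩)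
      rw [Function.onFun, (cmapOn_eq_iff hU).mpr (Or.inr habU)]

end MGraph

/-- If `F` is a 2-edge-connected subgraph of `G`, then the graph `G/E(F)` obtained by
contracting all edges of `F` is a cc-minor of `G`. -/
theorem statement_6 (G F : MGraph) (hsub : F.IsSubgraph G) (h2 : F.EdgeConnected 2) :
    G.CCMinor (G.contractOn F.V F.E) := by
  obtain ⟨hV, hE, hends⟩ := hsub
  refine MGraph.ccMinor_contractOn_of_bridgeless _ G F.V F.E rfl
    (Finset.card_pos.mp (by have := h2.1; omega)) hV hE
    (fun e he v hv => F.ends_mem e he v (by rwa [hends e he])) ?_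
  intro Z hZ hZ2 u hu v hv
  refine Relation.ReflTransGen.mono ?_ _ _ ((h2.2 Z hZ hZ2).2 u hu v hv)
  rintro a b ⟨f, hf, hab⟩
  exact ⟨f, hf, (hends f (Finset.mem_sdiff.mp hf).1).symm.trans hab⟩
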